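/- arXiv:2011.10383 — 2 statements merged into one kernel-verified Lean document; each statement's English description precedes it below -/
import Mathlib

section
/- Interpolation for G3iSL□: for every sequent Γ₁, Γ₂ ⇒ Δ derivable in G3iSL□ there exists a formula I such that every atom occurring in I occurs both in Γ₁ and in Γ₂ ∪ Δ, and both Γ₁ ⇒ I and Γ₂, I ⇒ Δ are derivable in G3iSL□. -/
/-- Formulas of propositional intuitionistic modal logic. -/
inductive Form : Type
  | atom : ℕ → Form
  | bot : Form
  | and : Form → Form → Form
  | or : Form → Form → Form
  | imp : Form → Form → Form
  | box : Form → Form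
  deriving DecidableEq

/-- □Γ : box every formula in the multiset. -/
def boxM (Γ : Multiset Form) : Multiset Form := Γ.map Form.box

/-- ⊡Γ = Γ ∪ □Γ (multiset union = sum). -/
def boxdot (Γ : Multiset Form) : Multiset Form := Γ + boxM Γ

/-- The multiset contains no boxed formulas. -/
def NoBox (P : Multiset Form) : Prop := ∀ φ ∈ P, ∀ ψ : Form, φ ≠ Form.box ψ

/-- The sequent calculus G3iSL□ with a height bound:
`G3iSL d Γ Δ` means that the sequent Γ ⇒ Δ has a (cutfree) G3iSL□-derivation
of height at most `d`. -/
inductive G3iSL : ℕ → Multiset Form → Option Form → Prop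
  | axAt {d : ℕ} {Γ : Multiset Form} {p : ℕ} :
      G3iSL (d + 1) (Form.atom p ::ₘ Γ) (some (Form.atom p))
  | axBot {d : ℕ} {Γ : Multiset Form} {Δ : Option Form} :
      G3iSL (d + 1) (Form.bot ::ₘ Γ) Δ
  | rAnd {d : ℕ} {Γ : Multiset Form} {φ ψ : Form} :
      G3iSL d Γ (some φ) → G3iSL d Γ (some ψ) →
      G3iSL (d + 1) Γ (some (Form.and φ ψ))
  | lAnd {d : ℕ} {Γ : Multiset Form} {φ ψ : Form} {Δ : Option Form} :
      G3iSL d (φ ::ₘ ψ ::ₘ Γ) Δ →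
      G3iSL (d + 1) (Form.and φ ψ ::ₘ Γ) Δ
  | rOrL {d : ℕ} {Γ : Multiset Form} {φ ψ : Form} :
      G3iSL d Γ (some φ) → G3iSL (d + 1) Γ (some (Form.or φ ψ))
  | rOrR {d : ℕ} {Γ : Multiset Form} {φ ψ : Form} :
      G3iSL d Γ (some ψ) → G3iSL (d + 1) Γ (some (Form.or φ ψ))
  | lOr {d : ℕ} {Γ : Multiset Form} {φ ψ : Form} {Δ : Option Form} :
      G3iSL d (φ ::ₘ Γ) Δ → G3iSL d (ψ ::ₘ Γ) Δ →
      G3iSL (d + 1) (Form.or φ ψ ::ₘ Γ) Δ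
  | rImp {d : ℕ} {Γ : Multiset Form} {φ ψ : Form} :
      G3iSL d (φ ::ₘ Γ) (some ψ) →
      G3iSL (d + 1) Γ (some (Form.imp φ ψ))
  | lImp {d : ℕ} {Γ : Multiset Form} {φ ψ : Form} {Δ : Option Form} :
      G3iSL d (Form.imp φ ψ ::ₘ Γ) (some φ) → G3iSL d (ψ ::ₘ Γ) Δ →
      G3iSL (d + 1) (Form.imp φ ψ ::ₘ Γ) Δ
  | rSL {d : ℕ} {S P Γ : Multiset Form} {φ : Form} :
      NoBox P →
      G3iSL d (Form.box φ ::ₘ (P + boxdot Γ)) (some φ) →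
      G3iSL (d + 1) (boxM S + P + boxM Γ) (some (Form.box φ))

/-- Derivability in G3iSL□ (some derivation of some height). -/
def G3Der (Γ : Multiset Form) (Δ : Option Form) : Prop := ∃ d, G3iSL d Γ Δ

/-- The set of atoms occurring in a formula. -/
def Form.atoms : Form → Finset ℕ
  | Form.atom p => {p}
  | Form.bot => ∅
  | Form.and a b => a.atoms ∪ b.atoms
  | Form.or a b => a.atoms ∪ b.atoms
  | Form.imp a b => a.atoms ∪ b.atoms
  | Form.box a => a.atoms

theorem G3iSL.mono {d e : ℕ} {Γ : Multiset Form} {Δ : Option Form} (h : G3iSL d Γ Δ)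
    (hde : d ≤ e) : G3iSL e Γ Δ := by
  induction h generalizing e <;> obtain ⟨e, rfl⟩ : ∃ k, e = k + 1 := ⟨e - 1, by omega⟩
  case axAt => exact .axAt
  case axBot => exact .axBot
  case rAnd ih₁ ih₂ => exact .rAnd (ih₁ (by omega)) (ih₂ (by omega))
  case lAnd ih => exact .lAnd (ih (by omega))
  case rOrL ih => exact .rOrL (ih (by omega))
  case rOrR ih => exact .rOrR (ih (by omega))
  case lOr ih₁ ih₂ => exact .lOr (ih₁ (by omega)) (ih₂ (by omega))
  case rImp ih => exact .rImp (ih (by omega))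
  case lImp ih₁ ih₂ => exact .lImp (ih₁ (by omega)) (ih₂ (by omega))
  case rSL hP _ ih => exact .rSL hP (ih (by omega))

theorem G3iSL.weaken_cons {d : ℕ} {Γ : Multiset Form} {Δ : Option Form} (h : G3iSL d Γ Δ)
    (χ : Form) : G3iSL d (χ ::ₘ Γ) Δ := by
  induction h with
  | axAt => rw [Multiset.cons_swap]; exact .axAt
  | axBot => rw [Multiset.cons_swap]; exact .axBot
  | rAnd _ _ ih₁ ih₂ => exact .rAnd ih₁ ih₂
  | @lAnd _ _ φ ψ _ _ ih =>
    rw [Multiset.cons_swap]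
    refine .lAnd ?_
    rwa [Multiset.cons_swap χ φ, Multiset.cons_swap χ ψ] at ih
  | rOrL _ ih => exact .rOrL ih
  | rOrR _ ih => exact .rOrR ih
  | lOr _ _ ih₁ ih₂ =>
    rw [Multiset.cons_swap]
    rw [Multiset.cons_swap] at ih₁ ih₂
    exact .lOr ih₁ ih₂
  | rImp _ ih =>
    rw [Multiset.cons_swap] at ih
    exact .rImp ih
  | lImp _ _ ih₁ ih₂ =>
    rw [Multiset.cons_swap]
    rw [Multiset.cons_swap] at ih₁ ih₂
    exact .lImp ih₁ ih₂
  | @rSL d S P Γ φ hP hd ih =>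
    by_cases hχ : ∃ θ, χ = .box θ
    · obtain ⟨θ, rfl⟩ := hχ
      have := G3iSL.rSL (S := θ ::ₘ S) hP hd
      simpa [boxM] using this
    · have hP' : NoBox (χ ::ₘ P) := by
        intro a ha b hab
        rcases Multiset.mem_cons.1 ha with rfl | ha
        · exact hχ ⟨b, hab⟩
        · exact hP a ha b hab
      rw [Multiset.cons_swap, ← Multiset.cons_add] at ih
      have := G3iSL.rSL (S := S) hP' ih
      simpa using this

theorem G3Der.weaken_cons {Γ : Multiset Form} {Δ : Option Form} (h : G3Der Γ Δ)
    (χ : Form) : G3Der (χ ::ₘ Γ) Δ :=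
  h.imp fun _ h => h.weaken_cons χ

namespace G3Der

variable {Γ : Multiset Form} {Δ : Option Form} {φ ψ : Form}

theorem axAt {p : ℕ} : G3Der (.atom p ::ₘ Γ) (some (.atom p)) := ⟨1, .axAt⟩

theorem axBot : G3Der (.bot ::ₘ Γ) Δ := ⟨1, .axBot⟩

theorem rAnd (h₁ : G3Der Γ (some φ)) (h₂ : G3Der Γ (some ψ)) :
    G3Der Γ (some (.and φ ψ)) :=
  let ⟨d, h₁⟩ := h₁
  let ⟨e, h₂⟩ := h₂
  ⟨max d e + 1, .rAnd (h₁.mono (le_max_left d e)) (h₂.mono (le_max_right d e))⟩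

theorem lAnd (h : G3Der (φ ::ₘ ψ ::ₘ Γ) Δ) : G3Der (.and φ ψ ::ₘ Γ) Δ :=
  let ⟨d, h⟩ := h
  ⟨d + 1, .lAnd h⟩

theorem rOrL (h : G3Der Γ (some φ)) : G3Der Γ (some (.or φ ψ)) :=
  let ⟨d, h⟩ := h
  ⟨d + 1, .rOrL h⟩

theorem rOrR (h : G3Der Γ (some ψ)) : G3Der Γ (some (.or φ ψ)) :=
  let ⟨d, h⟩ := h
  ⟨d + 1, .rOrR h⟩

theorem lOr (h₁ : G3Der (φ ::ₘ Γ) Δ) (h₂ : G3Der (ψ ::ₘ Γ) Δ) :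
    G3Der (.or φ ψ ::ₘ Γ) Δ :=
  let ⟨d, h₁⟩ := h₁
  let ⟨e, h₂⟩ := h₂
  ⟨max d e + 1, .lOr (h₁.mono (le_max_left d e)) (h₂.mono (le_max_right d e))⟩

theorem rImp (h : G3Der (φ ::ₘ Γ) (some ψ)) : G3Der Γ (some (.imp φ ψ)) :=
  let ⟨d, h⟩ := h
  ⟨d + 1, .rImp h⟩

theorem lImp (h₁ : G3Der (.imp φ ψ ::ₘ Γ) (some φ)) (h₂ : G3Der (ψ ::ₘ Γ) Δ) :
    G3Der (.imp φ ψ ::ₘ Γ) Δ :=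
  let ⟨d, h₁⟩ := h₁
  let ⟨e, h₂⟩ := h₂
  ⟨max d e + 1, .lImp (h₁.mono (le_max_left d e)) (h₂.mono (le_max_right d e))⟩

theorem rSL {S P : Multiset Form} (hP : NoBox P)
    (h : G3Der (.box φ ::ₘ (P + boxdot Γ)) (some φ)) :
    G3Der (boxM S + P + boxM Γ) (some (.box φ)) :=
  let ⟨d, h⟩ := h
  ⟨d + 1, .rSL hP h⟩

theorem rTop : G3Der Γ (some (.imp .bot .bot)) := rImp axBot

end G3Der

theorem Multiset.cons_eq_add {α : Type*} {a : α} {s t u : Multiset α} (h : a ::ₘ s = t + u) :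
    (∃ t', t = a ::ₘ t' ∧ s = t' + u) ∨ ∃ u', u = a ::ₘ u' ∧ s = t + u' := by
  have ha : a ∈ t + u := h ▸ Multiset.mem_cons_self a s
  rcases Multiset.mem_add.1 ha with ha | ha
  · obtain ⟨t', rfl⟩ := Multiset.exists_cons_of_mem ha
    exact .inl ⟨t', rfl, by simpa using h⟩
  · obtain ⟨u', rfl⟩ := Multiset.exists_cons_of_mem ha
    exact .inr ⟨u', rfl, by simpa using h⟩

theorem Multiset.add_eq_add_refine {α : Type*} {s t u v : Multiset α} (h : s + t = u + v) :
    ∃ u₁ u₂ v₁ v₂, s = u₁ + v₁ ∧ t = u₂ + v₂ ∧ u = u₁ + u₂ ∧ v = v₁ + v₂ := by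
  induction s using Multiset.induction_on generalizing u v with
  | empty => exact ⟨0, u, 0, v, by simpa using h⟩
  | cons a s ih =>
    rw [Multiset.cons_add] at h
    rcases Multiset.cons_eq_add h with ⟨u', rfl, h'⟩ | ⟨v', rfl, h'⟩
    · obtain ⟨u₁, u₂, v₁, v₂, rfl, rfl, rfl, rfl⟩ := ih h'
      exact ⟨a ::ₘ u₁, u₂, v₁, v₂, by simp⟩
    · obtain ⟨u₁, u₂, v₁, v₂, rfl, rfl, rfl, rfl⟩ := ih h'
      exact ⟨u₁, u₂, a ::ₘ v₁, v₂, by simp⟩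

theorem Multiset.map_eq_add_split {α β : Type*} {f : α → β} {s : Multiset α} {t u : Multiset β}
    (h : s.map f = t + u) : ∃ s₁ s₂, s = s₁ + s₂ ∧ t = s₁.map f ∧ u = s₂.map f := by
  induction s using Multiset.induction_on generalizing t u with
  | empty =>
    rw [Multiset.map_zero, eq_comm, add_eq_zero] at h
    exact ⟨0, 0, by simp [h]⟩
  | cons a s ih =>
    rw [Multiset.map_cons] at h
    rcases Multiset.cons_eq_add h with ⟨t', rfl, h'⟩ | ⟨u', rfl, h'⟩
    · obtain ⟨s₁, s₂, rfl, rfl, rfl⟩ := ih h'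
      exact ⟨a ::ₘ s₁, s₂, by simp⟩
    · obtain ⟨s₁, s₂, rfl, rfl, rfl⟩ := ih h'
      exact ⟨s₁, a ::ₘ s₂, by simp⟩

/-- The sequent obtained by joining `Γ₁` and `Γ₂` has an interpolant for this partition. -/
def HasInterpolant (Γ₁ Γ₂ : Multiset Form) (Δ : Option Form) : Prop :=
  ∃ I : Form,
    (∀ p ∈ I.atoms,
      (∃ φ ∈ Γ₁, p ∈ φ.atoms) ∧
      ((∃ φ ∈ Γ₂, p ∈ φ.atoms) ∨ ∃ ψ, Δ = some ψ ∧ p ∈ ψ.atoms)) ∧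
    G3Der Γ₁ (some I) ∧ G3Der (I ::ₘ Γ₂) Δ

theorem G3iSL.hasInterpolant {d : ℕ} {Γ Γ₁ Γ₂ : Multiset Form} {Δ : Option Form}
    (h : G3iSL d Γ Δ) (hΓ : Γ = Γ₁ + Γ₂) : HasInterpolant Γ₁ Γ₂ Δ := by
  induction h generalizing Γ₁ Γ₂ with
  | @axAt _ _ p =>
    rcases Multiset.cons_eq_add hΓ with ⟨Γ₁, rfl, rfl⟩ | ⟨Γ₂, rfl, rfl⟩
    · exact ⟨.atom p, by simp [Form.atoms], .axAt, .axAt⟩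
    · exact ⟨.imp .bot .bot, by simp [Form.atoms], .rTop, G3Der.axAt.weaken_cons _⟩
  | axBot =>
    rcases Multiset.cons_eq_add hΓ with ⟨Γ₁, rfl, rfl⟩ | ⟨Γ₂, rfl, rfl⟩
    · exact ⟨.bot, by simp [Form.atoms], .axBot, .axBot⟩
    · exact ⟨.imp .bot .bot, by simp [Form.atoms], .rTop, G3Der.axBot.weaken_cons _⟩
  | rAnd _ _ ih₁ ih₂ =>
    obtain ⟨I, hI, l₁, r₁⟩ := ih₁ hΓ
    obtain ⟨J, hJ, l₂, r₂⟩ := ih₂ hΓ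
    refine ⟨.and I J, ?_, .rAnd l₁ l₂, .lAnd (.rAnd ?_ (r₂.weaken_cons I))⟩
    · simp only [Form.atoms, Finset.mem_union, Option.some.injEq, exists_eq_left'] at *
      grind
    · rw [Multiset.cons_swap]; exact r₁.weaken_cons J
  | @lAnd _ _ φ ψ _ _ ih =>
    rcases Multiset.cons_eq_add hΓ with ⟨Γ₁, rfl, rfl⟩ | ⟨Γ₂, rfl, rfl⟩
    · obtain ⟨I, hI, l, r⟩ := ih (Γ₁ := φ ::ₘ ψ ::ₘ Γ₁) (Γ₂ := Γ₂) (by simp)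
      refine ⟨I, ?_, .lAnd l, r⟩
      simp only [Form.atoms, Finset.mem_union, Multiset.mem_cons, exists_eq_or_imp] at *
      grind
    · obtain ⟨I, hI, l, r⟩ := ih (Γ₁ := Γ₁) (Γ₂ := φ ::ₘ ψ ::ₘ Γ₂) (by simp)
      refine ⟨I, ?_, l, ?_⟩
      · simp only [Form.atoms, Finset.mem_union, Multiset.mem_cons, exists_eq_or_imp] at *
        grind
      · rw [Multiset.cons_swap I φ, Multiset.cons_swap I ψ] at r
        rw [Multiset.cons_swap]; exact r.lAnd
  | rOrL _ ih =>
    obtain ⟨I, hI, l, r⟩ := ih hΓ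
    refine ⟨I, ?_, l, .rOrL r⟩
    simp only [Form.atoms, Finset.mem_union, Option.some.injEq, exists_eq_left'] at *
    grind
  | rOrR _ ih =>
    obtain ⟨I, hI, l, r⟩ := ih hΓ
    refine ⟨I, ?_, l, .rOrR r⟩
    simp only [Form.atoms, Finset.mem_union, Option.some.injEq, exists_eq_left'] at *
    grind
  | @lOr _ _ φ ψ _ _ _ ih₁ ih₂ =>
    rcases Multiset.cons_eq_add hΓ with ⟨Γ₁, rfl, rfl⟩ | ⟨Γ₂, rfl, rfl⟩
    · obtain ⟨I, hI, l₁, r₁⟩ := ih₁ (Γ₁ := φ ::ₘ Γ₁) (Γ₂ := Γ₂) (by simp)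
      obtain ⟨J, hJ, l₂, r₂⟩ := ih₂ (Γ₁ := ψ ::ₘ Γ₁) (Γ₂ := Γ₂) (by simp)
      refine ⟨.or I J, ?_, .lOr (.rOrL l₁) (.rOrR l₂), .lOr r₁ r₂⟩
      simp only [Form.atoms, Finset.mem_union, Multiset.mem_cons, exists_eq_or_imp] at *
      grind
    · obtain ⟨I, hI, l₁, r₁⟩ := ih₁ (Γ₁ := Γ₁) (Γ₂ := φ ::ₘ Γ₂) (by simp)
      obtain ⟨J, hJ, l₂, r₂⟩ := ih₂ (Γ₁ := Γ₁) (Γ₂ := ψ ::ₘ Γ₂) (by simp)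
      refine ⟨.and I J, ?_, .rAnd l₁ l₂, .lAnd ?_⟩
      · simp only [Form.atoms, Finset.mem_union, Multiset.mem_cons, exists_eq_or_imp] at *
        grind
      · have r₁ := r₁.weaken_cons J
        have r₂ := r₂.weaken_cons I
        rw [Multiset.cons_swap I, Multiset.cons_swap J, Multiset.cons_swap J] at r₁
        rw [Multiset.cons_swap J, Multiset.cons_swap I] at r₂
        rw [Multiset.cons_swap J, Multiset.cons_swap I]
        exact .lOr r₁ r₂
  | @rImp _ _ φ ψ _ ih =>
    obtain ⟨I, hI, l, r⟩ := ih (Γ₁ := Γ₁) (Γ₂ := φ ::ₘ Γ₂) (by simp [hΓ])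
    refine ⟨I, ?_, l, .rImp (by rwa [Multiset.cons_swap])⟩
    simp only [Form.atoms, Finset.mem_union, Multiset.mem_cons, exists_eq_or_imp,
      Option.some.injEq, exists_eq_left'] at *
    grind
  | @lImp _ _ φ ψ _ _ _ ih₁ ih₂ =>
    rcases Multiset.cons_eq_add hΓ with ⟨Γ₁, rfl, rfl⟩ | ⟨Γ₂, rfl, rfl⟩
    · obtain ⟨I, hI, l₁, r₁⟩ := ih₁ (Γ₁ := Γ₂) (Γ₂ := .imp φ ψ ::ₘ Γ₁) (by simp [add_comm])
      obtain ⟨J, hJ, l₂, r₂⟩ := ih₂ (Γ₁ := ψ ::ₘ Γ₁) (Γ₂ := Γ₂) (by simp)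
      refine ⟨.imp I J, ?_, .rImp ?_, .lImp (l₁.weaken_cons _) r₂⟩
      · simp only [Form.atoms, Finset.mem_union, Multiset.mem_cons, exists_eq_or_imp,
          Option.some.injEq, exists_eq_left'] at *
        grind
      · have l₂ := l₂.weaken_cons I
        rw [Multiset.cons_swap] at r₁ l₂ ⊢
        exact .lImp r₁ l₂
    · obtain ⟨I, hI, l₁, r₁⟩ := ih₁ (Γ₁ := Γ₁) (Γ₂ := .imp φ ψ ::ₘ Γ₂) (by simp)
      obtain ⟨J, hJ, l₂, r₂⟩ := ih₂ (Γ₁ := Γ₁) (Γ₂ := ψ ::ₘ Γ₂) (by simp)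
      refine ⟨.and I J, ?_, .rAnd l₁ l₂, .lAnd ?_⟩
      · simp only [Form.atoms, Finset.mem_union, Multiset.mem_cons, exists_eq_or_imp,
          Option.some.injEq, exists_eq_left'] at *
        grind
      · have r₁ := r₁.weaken_cons J
        have r₂ := r₂.weaken_cons I
        rw [Multiset.cons_swap I, Multiset.cons_swap J, Multiset.cons_swap J] at r₁
        rw [Multiset.cons_swap J, Multiset.cons_swap I] at r₂
        rw [Multiset.cons_swap J, Multiset.cons_swap I]
        exact .lImp r₁ r₂
  | @rSL _ S P G φ hP _ ih =>
    obtain ⟨A₁, A₂, C₁, C₂, rfl, rfl, hA, hC⟩ := Multiset.add_eq_add_refine hΓ.symm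
    obtain ⟨B₁, B₂, P₁, P₂, rfl, rfl, hB, rfl⟩ := Multiset.add_eq_add_refine hA.symm
    obtain ⟨S₁, S₂, rfl, rfl, rfl⟩ := Multiset.map_eq_add_split hB
    obtain ⟨G₁, G₂, rfl, rfl, rfl⟩ := Multiset.map_eq_add_split hC
    obtain ⟨I, hI, l, r⟩ := ih (Γ₁ := P₁ + boxdot G₁) (Γ₂ := .box φ ::ₘ (P₂ + boxdot G₂))
      (by simp only [boxdot, boxM, Multiset.map_add, ← Multiset.singleton_add]; abel)
    refine ⟨.box I, ?_, ?_, ?_⟩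
    · simp only [boxdot, boxM, Form.atoms, Multiset.mem_add, Multiset.mem_cons, Multiset.mem_map,
        Option.some.injEq, exists_eq_left'] at *
      intro p hp
      obtain ⟨h₁, h₂⟩ := hI p hp
      grind [Form.atoms]
    · exact .rSL (fun a ha => hP a (Multiset.mem_add.2 (.inl ha))) (l.weaken_cons _)
    · have h := G3Der.rSL (S := S₂) (P := P₂) (Γ := I ::ₘ G₂) (φ := φ)
        (fun a ha => hP a (Multiset.mem_add.2 (.inr ha))) (by
          convert r.weaken_cons (.box I) using 1
          simp only [boxdot, boxM, ← Multiset.singleton_add, Multiset.map_add,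
            Multiset.map_singleton]
          abel)
      simpa [boxM] using h

/-- interpolation for G3iSL□. -/
theorem g3isl_interpolation (Γ₁ Γ₂ : Multiset Form) (Δ : Option Form)
    (h : G3Der (Γ₁ + Γ₂) Δ) :
    ∃ I : Form,
      (∀ p ∈ I.atoms,
        (∃ φ ∈ Γ₁, p ∈ φ.atoms) ∧
        ((∃ φ ∈ Γ₂, p ∈ φ.atoms) ∨ ∃ ψ, Δ = some ψ ∧ p ∈ ψ.atoms)) ∧
      G3Der Γ₁ (some I) ∧ G3Der (I ::ₘ Γ₂) Δ := by
  obtain ⟨_, h⟩ := h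
  exact h.hasInterpolant rfl
end

section
/- Completeness of G4iSL□ᵃ with respect to iSL-models: if the sequent Γ ⇒ Δ is not derivable in G4iSL□ᵃ, then there exists a finite iSL-model and a world in it that forces every formula of Γ but does not force the formula of Δ. Equivalently, if Γ ⊨ Δ then Γ ⇒ Δ is derivable in G4iSL□ᵃ. -/
/-- The sequent calculus G4iSL□ᵃ. -/
inductive G4a : Multiset Form → Option Form → Prop
  | axAt {Γ : Multiset Form} {p : ℕ} :
      G4a (Form.atom p ::ₘ Γ) (some (Form.atom p))
  | axBot {Γ : Multiset Form} {Δ : Option Form} :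
      G4a (Form.bot ::ₘ Γ) Δ
  | rAnd {Γ : Multiset Form} {φ ψ : Form} :
      G4a Γ (some φ) → G4a Γ (some ψ) → G4a Γ (some (Form.and φ ψ))
  | lAnd {Γ : Multiset Form} {φ ψ : Form} {Δ : Option Form} :
      G4a (φ ::ₘ ψ ::ₘ Γ) Δ → G4a (Form.and φ ψ ::ₘ Γ) Δ
  | rOrL {Γ : Multiset Form} {φ ψ : Form} :
      G4a Γ (some φ) → G4a Γ (some (Form.or φ ψ))
  | rOrR {Γ : Multiset Form} {φ ψ : Form} :
      G4a Γ (some ψ) → G4a Γ (some (Form.or φ ψ))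
  | lOr {Γ : Multiset Form} {φ ψ : Form} {Δ : Option Form} :
      G4a (φ ::ₘ Γ) Δ → G4a (ψ ::ₘ Γ) Δ → G4a (Form.or φ ψ ::ₘ Γ) Δ
  | rImp {Γ : Multiset Form} {φ ψ : Form} :
      G4a (φ ::ₘ Γ) (some ψ) → G4a Γ (some (Form.imp φ ψ))
  | lAtImp {Γ : Multiset Form} {p : ℕ} {φ : Form} {Δ : Option Form} :
      G4a (Form.atom p ::ₘ φ ::ₘ Γ) Δ →
      G4a (Form.atom p ::ₘ Form.imp (Form.atom p) φ ::ₘ Γ) Δ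
  | lAndImp {Γ : Multiset Form} {φ ψ χ : Form} {Δ : Option Form} :
      G4a (Form.imp φ (Form.imp ψ χ) ::ₘ Γ) Δ →
      G4a (Form.imp (Form.and φ ψ) χ ::ₘ Γ) Δ
  | lOrImp {Γ : Multiset Form} {φ ψ χ : Form} {Δ : Option Form} :
      G4a (Form.imp φ χ ::ₘ Form.imp ψ χ ::ₘ Γ) Δ →
      G4a (Form.imp (Form.or φ ψ) χ ::ₘ Γ) Δ
  | lImpImpA {Γ : Multiset Form} {φ ψ χ : Form} {Δ : Option Form} :
      G4a (φ ::ₘ Form.imp ψ χ ::ₘ Γ) (some ψ) →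
      G4a (χ ::ₘ Γ) Δ →
      G4a (Form.imp (Form.imp φ ψ) χ ::ₘ Γ) Δ
  | impSL1 {P Γ : Multiset Form} {φ ψ : Form} {Δ : Option Form} :
      NoBox P → Form.box φ ∉ boxM Γ →
      G4a (Form.imp (Form.box φ) ψ ::ₘ Form.box φ ::ₘ (P + boxdot Γ)) (some φ) →
      G4a (ψ ::ₘ (P + boxM Γ)) Δ →
      G4a (Form.imp (Form.box φ) ψ ::ₘ (P + boxM Γ)) Δ
  | impSL2 {P Γ : Multiset Form} {φ ψ : Form} {Δ : Option Form} :
      NoBox P → Form.box φ ∈ boxM Γ →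
      G4a (ψ ::ₘ (P + boxM Γ)) Δ →
      G4a (Form.imp (Form.box φ) ψ ::ₘ (P + boxM Γ)) Δ
  | rSLa {P Γ : Multiset Form} {φ : Form} :
      NoBox P →
      G4a (Form.box φ ::ₘ (P + boxdot Γ)) (some φ) →
      G4a (P + boxM Γ) (some (Form.box φ))

/-- iSL-models: intuitionistic modal Kripke models in which the modal relation
is transitive, conversely well-founded and a subset of the intuitionistic order. -/
structure ISLModel where
  W : Type
  nonempty : Nonempty W
  le : W → W → Prop
  le_refl : ∀ w, le w w
  le_trans : ∀ ⦃a b c⦄, le a b → le b c → le a c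
  le_antisymm : ∀ ⦃a b⦄, le a b → le b a → a = b
  R : W → W → Prop
  le_R : ∀ ⦃w v x⦄, le w v → R v x → R w x
  V : W → ℕ → Prop
  mono : ∀ ⦃w v⦄, le w v → ∀ ⦃p⦄, V w p → V v p
  R_trans : ∀ ⦃a b c⦄, R a b → R b c → R a c
  /-- conversely well-founded: there is no infinite R-path -/
  cwf : ∀ f : ℕ → W, ¬ ∀ n, R (f n) (f (n + 1))
  R_le : ∀ ⦃a b⦄, R a b → le a b

/-- The forcing relation. -/
def Force (M : ISLModel) : M.W → Form → Prop
  | w, .atom p => M.V w p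
  | _, .bot => False
  | w, .and a b => Force M w a ∧ Force M w b
  | w, .or a b => Force M w a ∨ Force M w b
  | w, .imp a b => ∀ v : M.W, M.le w v → Force M v a → Force M v b
  | w, .box a => ∀ x : M.W, M.R w x → Force M x a

/-- A world forces the (at most one) formula of the succedent. -/
def ForceSuc (M : ISLModel) (w : M.W) (Δ : Option Form) : Prop :=
  ∃ ψ, Δ = some ψ ∧ Force M w ψ

/-- Semantic consequence over all iSL-models. -/
def SemConseq (Γ : Multiset Form) (Δ : Option Form) : Prop :=
  ∀ (M : ISLModel) (w : M.W), (∀ φ ∈ Γ, Force M w φ) → ForceSuc M w Δ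

namespace Form

/-- A weight for which the premises of the propositional rules are lighter than their conclusion. -/
def weight : Form → ℕ
  | atom _ => 1
  | bot => 1
  | and a b => a.weight + b.weight + 2
  | or a b => a.weight + b.weight + 1
  | imp a b => a.weight + b.weight + 1
  | box a => a.weight + 1

/-- The formulas `a` such that `□a` is a subformula. -/
def boxedSub : Form → Finset Form
  | atom _ => ∅
  | bot => ∅
  | and a b => a.boxedSub ∪ b.boxedSub
  | or a b => a.boxedSub ∪ b.boxedSub
  | imp a b => a.boxedSub ∪ b.boxedSub
  | box a => insert a a.boxedSub

/-- The finite set of subformulas. -/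
def sub : Form → Finset Form
  | atom p => {atom p}
  | bot => {bot}
  | and a b => insert (and a b) (a.sub ∪ b.sub)
  | or a b => insert (or a b) (a.sub ∪ b.sub)
  | imp a b => insert (imp a b) (a.sub ∪ b.sub)
  | box a => insert (box a) a.sub

theorem self_mem_sub (φ : Form) : φ ∈ φ.sub := by
  cases φ <;> simp [sub]

end Form

theorem force_mono (M : ISLModel) (φ : Form) :
    ∀ {w v : M.W}, M.le w v → Force M w φ → Force M v φ := by
  induction φ with
  | atom p => exact fun h hw => M.mono h hw
  | bot => exact fun _ hw => hw
  | and a b iha ihb => exact fun h hw => ⟨iha h hw.1, ihb h hw.2⟩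
  | or a b iha ihb => exact fun h hw => hw.imp (iha h) (ihb h)
  | imp a b _ _ => exact fun h hw x hx => hw x (M.le_trans h hx)
  | box a _ => exact fun h hw x hx => hw x (M.le_R h hx)

/-! ### Adding a root below a family of pointed models -/

section Glue

variable {ι : Type} (M : ι → ISLModel) (u : ∀ i, (M i).W) (modal : ι → Prop)

inductive GlueLe : Option (Σ i, (M i).W) → Option (Σ i, (M i).W) → Prop
  | root : GlueLe none none
  | up {i : ι} {x : (M i).W} : (M i).le (u i) x → GlueLe none (some ⟨i, x⟩)
  | inner {i : ι} {x y : (M i).W} : (M i).le x y → GlueLe (some ⟨i, x⟩) (some ⟨i, y⟩)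

inductive GlueR : Option (Σ i, (M i).W) → Option (Σ i, (M i).W) → Prop
  | up {i : ι} {x : (M i).W} : (M i).R (u i) x → GlueR none (some ⟨i, x⟩)
  | point {i : ι} : modal i → GlueR none (some ⟨i, u i⟩)
  | inner {i : ι} {x y : (M i).W} : (M i).R x y → GlueR (some ⟨i, x⟩) (some ⟨i, y⟩)

variable {M u modal}

theorem GlueLe.inner_iff {i : ι} {x y : (M i).W} :
    GlueLe M u (some ⟨i, x⟩) (some ⟨i, y⟩) ↔ (M i).le x y :=
  ⟨fun h => by cases h; assumption, .inner⟩

theorem GlueR.inner_iff {i : ι} {x y : (M i).W} :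
    GlueR M u modal (some ⟨i, x⟩) (some ⟨i, y⟩) ↔ (M i).R x y :=
  ⟨fun h => by cases h; assumption, .inner⟩

theorem GlueR.no_path (f : ℕ → Option (Σ i, (M i).W)) :
    ¬ ∀ n, GlueR M u modal (f n) (f (n + 1)) := by
  intro hf
  obtain ⟨i, x₀, h₀⟩ : ∃ i x, f 1 = some ⟨i, x⟩ := by
    have h := hf 0
    generalize f 0 = a, f (0 + 1) = b at h
    cases h <;> exact ⟨_, _, rfl⟩
  have key : ∀ n, ∃ x, f (n + 1) = some ⟨i, x⟩ := by
    intro n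
    induction n with
    | zero => exact ⟨x₀, h₀⟩
    | succ n ih =>
      obtain ⟨x, hx⟩ := ih
      have h := hf (n + 1)
      rw [hx] at h
      generalize f (n + 1 + 1) = b at h ⊢
      cases h
      exact ⟨_, rfl⟩
  choose g hg using key
  refine (M i).cwf g fun n => ?_
  have h := hf (n + 1)
  rw [hg n, hg (n + 1)] at h
  exact GlueR.inner_iff.1 h

variable (M u modal) in
/-- The model with a new root below the points `u i`, at which exactly the atoms in `A` hold;
the root is modally related to `u i` when `modal i` holds. -/
def glue (A : ℕ → Prop) (hA : ∀ i p, A p → (M i).V (u i) p) : ISLModel where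
  W := Option (Σ i, (M i).W)
  nonempty := ⟨none⟩
  le := GlueLe M u
  le_refl
    | none => .root
    | some ⟨i, x⟩ => .inner ((M i).le_refl x)
  le_trans := by
    intro a b c h k
    cases h with
    | root => exact k
    | up h => cases k with | inner k => exact .up ((M _).le_trans h k)
    | inner h => cases k with | inner k => exact .inner ((M _).le_trans h k)
  le_antisymm := by
    intro a b h k
    cases h with
    | root => rfl
    | up h => cases k
    | inner h => rw [(M _).le_antisymm h (GlueLe.inner_iff.1 k)]
  R := GlueR M u modal
  le_R := by
    intro a b c h k
    cases h with
    | root => exact k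
    | up h => cases k with | inner k => exact .up ((M _).le_R h k)
    | inner h => cases k with | inner k => exact .inner ((M _).le_R h k)
  V
    | none, p => A p
    | some ⟨i, x⟩, p => (M i).V x p
  mono := by
    intro a b h p hp
    cases h with
    | root => exact hp
    | up h => exact (M _).mono h (hA _ _ hp)
    | inner h => exact (M _).mono h hp
  R_trans := by
    intro a b c h k
    cases h with
    | up h => cases k with | inner k => exact .up ((M _).R_trans h k)
    | point h => cases k with | inner k => exact .up k
    | inner h => cases k with | inner k => exact .inner ((M _).R_trans h k)
  cwf := GlueR.no_path
  R_le := by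
    intro a b h
    cases h with
    | up h => exact .up ((M _).R_le h)
    | point h => exact .up ((M _).le_refl _)
    | inner h => exact .inner ((M _).R_le h)

theorem force_glue_some {A : ℕ → Prop} (hA : ∀ i p, A p → (M i).V (u i) p) (φ : Form) :
    ∀ {i : ι} {x : (M i).W},
      Force (glue M u modal A hA) (some ⟨i, x⟩) φ ↔ Force (M i) x φ := by
  induction φ with
  | atom p => exact Iff.rfl
  | bot => exact Iff.rfl
  | and a b iha ihb => exact and_congr iha ihb
  | or a b iha ihb => exact or_congr iha ihb
  | imp a b iha ihb =>
    intro i x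
    constructor
    · exact fun h y hy hya => ihb.1 (h (some ⟨i, y⟩) (.inner hy) (iha.2 hya))
    · intro h y hy hya
      cases hy with
      | inner hy => exact ihb.2 (h _ hy (iha.1 hya))
  | box a iha =>
    intro i x
    constructor
    · exact fun h y hy => iha.1 (h (some ⟨i, y⟩) (.inner hy))
    · intro h y hy
      cases hy with
      | inner hy => exact iha.2 (h _ hy)

end Glue

/-- A finite model of `Γ` refutes `θ`; for `b = true` it also forces every `χ` with `□χ ∈ Γ`. -/
def Refutable (Γ : Multiset Form) (b : Bool) (θ : Form) : Prop :=
  ∃ M : ISLModel, Finite M.W ∧ ∃ w : M.W, (∀ φ ∈ Γ, Force M w φ) ∧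
    (b = true → ∀ χ, Form.box χ ∈ Γ → Force M w χ) ∧ ¬ Force M w θ

theorem exists_rooted_model (Γ : Multiset Form) (F : Finset Form) :
    ∃ M : ISLModel, Finite M.W ∧ ∃ r : M.W,
      (∀ p, M.V r p ↔ Form.atom p ∈ Γ) ∧
      (∀ v, M.le r v → v = r ∨ ∀ φ ∈ Γ, Force M v φ) ∧
      (∀ x, M.R r x → ∀ χ, Form.box χ ∈ Γ → Force M x χ) ∧
      (∀ θ ∈ F, Refutable Γ false θ → ¬ Force M r θ) ∧
      (∀ θ ∈ F, Refutable Γ true θ → ¬ Force M r (Form.box θ)) := by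
  let ι := {x : Bool × F // Refutable Γ x.1 x.2}
  choose M hfin u hu hub hne using fun i : ι => i.2
  let N := glue M u (fun i => i.1.1 = true) (fun p => Form.atom p ∈ Γ) fun i p hp => hu i _ hp
  refine ⟨N, ?_, none, fun p => Iff.rfl, ?_, ?_, ?_, ?_⟩
  · have : ∀ i, Finite (M i).W := hfin
    exact inferInstanceAs (Finite (Option (Σ i, (M i).W)))
  · intro v hv
    cases hv with
    | root => exact .inl rfl
    | up h =>
      exact .inr fun φ hφ => (force_glue_some _ φ).2 (force_mono _ φ h (hu _ φ hφ))
  · intro x hx χ hχ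
    cases hx with
    | up h => exact (force_glue_some _ χ).2 (hu _ _ hχ _ h)
    | point h => exact (force_glue_some _ χ).2 (hub _ h χ hχ)
  · intro θ hθ hr hf
    let i : ι := ⟨(false, ⟨θ, hθ⟩), hr⟩
    exact hne i ((force_glue_some _ θ).1
      (force_mono N θ (v := some ⟨i, u i⟩) (.up ((M i).le_refl _)) hf))
  · intro θ hθ hr hf
    let i : ι := ⟨(true, ⟨θ, hθ⟩), hr⟩
    exact hne i ((force_glue_some _ θ).1 (hf (some ⟨i, u i⟩) (.point rfl)))

/-! ### Derivability of generalized axioms -/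

theorem exists_eq_add_boxM (Γ : Multiset Form) : ∃ P Γ₀, NoBox P ∧ Γ = P + boxM Γ₀ := by
  induction Γ using Multiset.induction with
  | empty => exact ⟨0, 0, by simp [NoBox], by simp [boxM]⟩
  | cons a Γ ih =>
    obtain ⟨P, Γ₀, hP, rfl⟩ := ih
    by_cases ha : ∃ b, a = Form.box b
    · obtain ⟨b, rfl⟩ := ha
      exact ⟨P, b ::ₘ Γ₀, hP, by simp [boxM]⟩
    · refine ⟨a ::ₘ P, Γ₀, ?_, by simp⟩
      intro φ hφ ψ h
      rcases Multiset.mem_cons.1 hφ with rfl | hφ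
      · exact ha ⟨ψ, h⟩
      · exact hP φ hφ ψ h

theorem box_mem_add_boxM {P Γ : Multiset Form} (hP : NoBox P) {a : Form} :
    Form.box a ∈ P + boxM Γ ↔ a ∈ Γ := by
  have : Form.box a ∉ P := fun h => hP _ h a rfl
  simp [boxM, this]

theorem G4a.identity_and_detachment (φ : Form) :
    (∀ Γ, G4a (φ ::ₘ Γ) (some φ)) ∧
    (∀ Γ χ Δ, (∀ Γ', Γ ≤ Γ' → G4a (χ ::ₘ Γ') Δ) → G4a (φ ::ₘ Form.imp φ χ ::ₘ Γ) Δ) := by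
  induction φ with
  | atom p =>
    refine ⟨fun Γ => .axAt, fun Γ χ Δ h => .lAtImp ?_⟩
    rw [Multiset.cons_swap]
    exact h _ (Multiset.le_cons_self _ _)
  | bot => exact ⟨fun Γ => .axBot, fun Γ χ Δ h => .axBot⟩
  | and a b iha ihb =>
    refine ⟨fun Γ => .lAnd (.rAnd (iha.1 _) ?_), fun Γ χ Δ h => .lAnd ?_⟩
    · rw [Multiset.cons_swap]
      exact ihb.1 _
    · rw [Multiset.cons_swap b, Multiset.cons_swap a]
      refine .lAndImp ?_
      rw [Multiset.cons_swap]
      refine iha.2 _ _ _ fun Γ' hΓ' => ?_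
      obtain ⟨Γ'', rfl⟩ := Multiset.exists_cons_of_mem
        (Multiset.mem_of_le hΓ' (Multiset.mem_cons_self _ _))
      rw [Multiset.cons_swap]
      exact ihb.2 _ _ _ fun Θ hΘ => h _ (((Multiset.cons_le_cons_iff b).1 hΓ').trans hΘ)
  | or a b iha ihb =>
    refine ⟨fun Γ => .lOr (.rOrL (iha.1 _)) (.rOrR (ihb.1 _)), fun Γ χ Δ h => .lOr ?_ ?_⟩
    · rw [Multiset.cons_swap]
      refine .lOrImp ?_
      rw [Multiset.cons_swap _ a, Multiset.cons_swap _ a]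
      exact iha.2 _ _ _ fun Θ hΘ => h _ ((Multiset.le_cons_self _ _).trans hΘ)
    · rw [Multiset.cons_swap]
      refine .lOrImp ?_
      rw [Multiset.cons_swap _ b, Multiset.cons_swap _ b, Multiset.cons_swap _ (b.imp χ)]
      exact ihb.2 _ _ _ fun Θ hΘ => h _ ((Multiset.le_cons_self _ _).trans hΘ)
  | imp a b iha ihb =>
    refine ⟨fun Γ => .rImp (iha.2 _ _ _ fun Θ _ => ihb.1 _), fun Γ χ Δ h => ?_⟩
    rw [Multiset.cons_swap]
    refine .lImpImpA ?_ (h _ (Multiset.le_cons_self _ _))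
    rw [Multiset.cons_swap _ (a.imp b)]
    exact iha.2 _ _ _ fun Θ _ => ihb.1 _
  | box a iha =>
    constructor
    · intro Γ
      obtain ⟨P, Γ₀, hP, rfl⟩ := exists_eq_add_boxM Γ
      have : Form.box a ::ₘ (P + boxM Γ₀) = P + boxM (a ::ₘ Γ₀) := by simp [boxM]
      rw [this]
      refine .rSLa hP ?_
      obtain ⟨Θ, hΘ⟩ := Multiset.exists_cons_of_mem
        (show a ∈ Form.box a ::ₘ (P + boxdot (a ::ₘ Γ₀)) by simp [boxdot])
      rw [hΘ]
      exact iha.1 _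
    · intro Γ χ Δ h
      obtain ⟨P, Γ₀, hP, rfl⟩ := exists_eq_add_boxM Γ
      have : Form.box a ::ₘ (P + boxM Γ₀) = P + boxM (a ::ₘ Γ₀) := by simp [boxM]
      rw [Multiset.cons_swap, this]
      refine .impSL2 hP (by simp [boxM]) ?_
      rw [← this]
      exact h _ (Multiset.le_cons_self _ _)

theorem G4a.of_mem {Γ : Multiset Form} {φ : Form} (h : φ ∈ Γ) : G4a Γ (some φ) := by
  obtain ⟨Θ, rfl⟩ := Multiset.exists_cons_of_mem h
  exact (identity_and_detachment φ).1 Θ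

/-! ### The termination measure -/

/-- All formulas of a sequent. -/
def seqForms (Γ : Multiset Form) (Δ : Option Form) : Multiset Form :=
  Γ + Δ.elim 0 fun φ => {φ}

theorem mem_seqForms {Γ : Multiset Form} {Δ : Option Form} {φ : Form} :
    φ ∈ seqForms Γ Δ ↔ φ ∈ Γ ∨ Δ = some φ := by
  cases Δ <;> simp [seqForms, eq_comm]

/-- The formulas `a` such that `□a` occurs in the sequent as a subformula. -/
def seqBoxed (Γ : Multiset Form) (Δ : Option Form) : Finset Form :=
  (seqForms Γ Δ).toFinset.biUnion Form.boxedSub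

theorem mem_seqBoxed {Γ : Multiset Form} {Δ : Option Form} {a : Form} :
    a ∈ seqBoxed Γ Δ ↔ (∃ φ ∈ Γ, a ∈ φ.boxedSub) ∨ ∃ φ, Δ = some φ ∧ a ∈ φ.boxedSub := by
  simp [seqBoxed, mem_seqForms, or_and_right, exists_or]

def seqMissing (Γ : Multiset Form) (Δ : Option Form) : Finset Form :=
  (seqBoxed Γ Δ).filter fun a => Form.box a ∉ Γ

def seqCost (Γ : Multiset Form) (Δ : Option Form) : ℕ :=
  ((seqForms Γ Δ).map fun φ => 4 ^ φ.weight).sum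

/-- The sequent has a finite countermodel. -/
def HasCountermodel (Γ : Multiset Form) (Δ : Option Form) : Prop :=
  ∃ M : ISLModel, Finite M.W ∧ ∃ w : M.W, (∀ φ ∈ Γ, Force M w φ) ∧ ¬ ForceSuc M w Δ

theorem HasCountermodel.of_forall_force {Γ Γ' : Multiset Form} {Δ Δ' : Option Form}
    (h : HasCountermodel Γ' Δ')
    (hF : ∀ (M : ISLModel) (w : M.W), (∀ φ ∈ Γ', Force M w φ) →
      (∀ φ ∈ Γ, Force M w φ) ∧ (ForceSuc M w Δ → ForceSuc M w Δ')) :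
    HasCountermodel Γ Δ := by
  obtain ⟨M, hM, w, hw, hn⟩ := h
  exact ⟨M, hM, w, (hF M w hw).1, fun h => hn ((hF M w hw).2 h)⟩

theorem mem_seqBoxed_cons {Γ : Multiset Form} {Δ : Option Form} {φ a : Form} :
    a ∈ seqBoxed (φ ::ₘ Γ) Δ ↔ a ∈ φ.boxedSub ∨ a ∈ seqBoxed Γ Δ := by
  simp [mem_seqBoxed, or_and_right, exists_or, or_assoc]

theorem mem_seqBoxed_some {Γ : Multiset Form} {φ a : Form} :
    a ∈ seqBoxed Γ (some φ) ↔ a ∈ φ.boxedSub ∨ a ∈ seqBoxed Γ none := by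
  simp [mem_seqBoxed, or_comm]

theorem seqBoxed_none_subset {Γ : Multiset Form} {Δ : Option Form} {a : Form}
    (h : a ∈ seqBoxed Γ none) : a ∈ seqBoxed Γ Δ := by
  simp only [mem_seqBoxed, reduceCtorEq, false_and, exists_false, or_false] at h ⊢
  exact .inl h

theorem seqBoxed_boxdot {P Γ : Multiset Form} {a : Form}
    (h : a ∈ seqBoxed (P + boxdot Γ) none) : a ∈ seqBoxed (P + boxM Γ) none := by
  simp only [mem_seqBoxed, reduceCtorEq, false_and, exists_false, or_false] at h ⊢
  obtain ⟨φ, hφ, ha⟩ := h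
  simp only [boxdot, Multiset.mem_add] at hφ
  rcases hφ with hφ | hφ | hφ
  · exact ⟨φ, by simp [hφ], ha⟩
  · exact ⟨φ.box, by simp [boxM, hφ], by simp [Form.boxedSub, ha]⟩
  · exact ⟨φ, by simp [hφ], ha⟩

theorem seqCost_cons {Γ : Multiset Form} {Δ : Option Form} {φ : Form} :
    seqCost (φ ::ₘ Γ) Δ = 4 ^ φ.weight + seqCost Γ Δ := by
  simp [seqCost, seqForms]

theorem seqCost_some {Γ : Multiset Form} {φ : Form} :
    seqCost Γ (some φ) = 4 ^ φ.weight + seqCost Γ none := by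
  simp [seqCost, seqForms, add_comm]

theorem seqCost_none_le {Γ : Multiset Form} {Δ : Option Form} :
    seqCost Γ none ≤ seqCost Γ Δ := by
  simp [seqCost, seqForms]

theorem four_mul_pow_le {a b : ℕ} (h : a < b) : 0 < 4 ^ a ∧ 4 * 4 ^ a ≤ 4 ^ b :=
  ⟨by positivity, by rw [← pow_succ']; exact Nat.pow_le_pow_right (by norm_num) h⟩

theorem force_imp_of_force {M : ISLModel} {w : M.W} {φ ψ : Form} (h : Force M w ψ) :
    Force M w (Form.imp φ ψ) :=
  fun _ hv _ => force_mono M ψ hv h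

theorem forceSuc_some {M : ISLModel} {w : M.W} {φ : Form} :
    ForceSuc M w (some φ) ↔ Force M w φ := by
  simp [ForceSuc]

theorem forall_force_cons {M : ISLModel} {w : M.W} {φ : Form} {Γ : Multiset Form} :
    (∀ χ ∈ φ ::ₘ Γ, Force M w χ) ↔ Force M w φ ∧ ∀ χ ∈ Γ, Force M w χ := by
  simp

/-- A saturated sequent, all of whose remaining unprovable premises are refutable, has a
countermodel. -/
theorem hasCountermodel_of_saturated {Γ : Multiset Form} {Δ : Option Form}
    (hand : ∀ φ ψ, Form.and φ ψ ∉ Γ) (hor : ∀ φ ψ, Form.or φ ψ ∉ Γ) (hbot : Form.bot ∉ Γ)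
    (hat : ∀ p φ, Form.atom p ∈ Γ → Form.imp (Form.atom p) φ ∉ Γ)
    (handimp : ∀ φ ψ χ, Form.imp (Form.and φ ψ) χ ∉ Γ)
    (horimp : ∀ φ ψ χ, Form.imp (Form.or φ ψ) χ ∉ Γ)
    (himp : ∀ φ ψ χ, Form.imp (Form.imp φ ψ) χ ∈ Γ → Refutable Γ false (Form.imp φ ψ))
    (hbox : ∀ φ χ, Form.imp (Form.box φ) χ ∈ Γ → Refutable Γ true φ)
    (hsatom : ∀ p, Δ = some (Form.atom p) → Form.atom p ∉ Γ)
    (hsand : ∀ φ ψ, Δ ≠ some (Form.and φ ψ)) (hsimp : ∀ φ ψ, Δ ≠ some (Form.imp φ ψ))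
    (hsor : ∀ φ ψ, Δ = some (Form.or φ ψ) → Refutable Γ false φ ∧ Refutable Γ false ψ)
    (hsbox : ∀ φ, Δ = some (Form.box φ) → Refutable Γ true φ) :
    HasCountermodel Γ Δ := by
  obtain ⟨M, hM, r, hV, hle, hR, hF, hFbox⟩ :=
    exists_rooted_model Γ ((seqForms Γ Δ).toFinset.biUnion Form.sub)
  have hmem : ∀ {φ ψ}, φ ∈ seqForms Γ Δ → ψ ∈ φ.sub →
      ψ ∈ (seqForms Γ Δ).toFinset.biUnion Form.sub := by
    intro φ ψ h h'
    simp only [Finset.mem_biUnion, Multiset.mem_toFinset]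
    exact ⟨φ, h, h'⟩
  refine ⟨M, hM, r, ?_, ?_⟩
  · intro φ hφ
    have hφ' : φ ∈ seqForms Γ Δ := mem_seqForms.2 (.inl hφ)
    cases φ with
    | atom p => exact (hV p).2 hφ
    | bot => exact absurd hφ hbot
    | and a b => exact absurd hφ (hand a b)
    | or a b => exact absurd hφ (hor a b)
    | box a => exact fun x hx => hR x hx a hφ
    | imp a b =>
      intro v hv hva
      rcases hle v hv with rfl | h
      · exfalso
        cases a with
        | atom p => exact hat p b ((hV p).1 hva) hφ
        | bot => exact hva
        | and a c => exact handimp a c b hφ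
        | or a c => exact horimp a c b hφ
        | imp a c =>
          exact hF _ (hmem hφ' (by simp [Form.sub])) (himp a c b hφ) hva
        | box a =>
          exact hFbox _ (hmem hφ' (by simp [Form.sub, Form.self_mem_sub])) (hbox a b hφ) hva
      · exact h _ hφ v (M.le_refl v) hva
  · rintro ⟨φ, rfl, hφ⟩
    have hφ' : φ ∈ seqForms Γ (some φ) := mem_seqForms.2 (.inr rfl)
    cases φ with
    | atom p => exact hsatom p rfl ((hV p).1 hφ)
    | bot => exact hφ
    | and a b => exact hsand a b rfl
    | imp a b => exact hsimp a b rfl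
    | or a b =>
      obtain ⟨ha, hb⟩ := hsor a b rfl
      rcases hφ with hφ | hφ
      · exact hF _ (hmem hφ' (by simp [Form.sub, Form.self_mem_sub])) ha hφ
      · exact hF _ (hmem hφ' (by simp [Form.sub, Form.self_mem_sub])) hb hφ
    | box a => exact hFbox _ (hmem hφ' (by simp [Form.sub, Form.self_mem_sub])) (hsbox a rfl) hφ

theorem HasCountermodel.refutable {Γ Γ' : Multiset Form} {θ θ' : Form} {b : Bool}
    (h : HasCountermodel Γ' (some θ'))
    (hF : ∀ (M : ISLModel) (w : M.W), (∀ φ ∈ Γ', Force M w φ) →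
      (∀ φ ∈ Γ, Force M w φ) ∧ (b = true → ∀ χ, Form.box χ ∈ Γ → Force M w χ) ∧
        (Force M w θ → Force M w θ')) :
    Refutable Γ b θ := by
  obtain ⟨M, hM, w, hw, hn⟩ := h
  obtain ⟨h₁, h₂, h₃⟩ := hF M w hw
  exact ⟨M, hM, w, h₁, h₂, fun h => hn (forceSuc_some.2 (h₃ h))⟩

theorem hasCountermodel_step {Γ : Multiset Form} {Δ : Option Form}
    (ih : ∀ Γ' Δ', (∀ a, a ∈ seqBoxed Γ' Δ' → a ∈ seqBoxed Γ Δ) →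
      (∀ a, Form.box a ∈ Γ → Form.box a ∈ Γ') → seqCost Γ' Δ' < seqCost Γ Δ →
      ¬ G4a Γ' Δ' → HasCountermodel Γ' Δ')
    (ihbox : ∀ Γ' Δ' a, (∀ a, a ∈ seqBoxed Γ' Δ' → a ∈ seqBoxed Γ Δ) →
      (∀ a, Form.box a ∈ Γ → Form.box a ∈ Γ') →
      a ∈ seqBoxed Γ Δ → Form.box a ∉ Γ → Form.box a ∈ Γ' →
      ¬ G4a Γ' Δ' → HasCountermodel Γ' Δ')
    (hn : ¬ G4a Γ Δ) : HasCountermodel Γ Δ := by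
  by_cases hand : ∃ φ ψ, Form.and φ ψ ∈ Γ
  · obtain ⟨φ, ψ, h⟩ := hand
    obtain ⟨Γ, rfl⟩ := Multiset.exists_cons_of_mem h
    refine (ih (φ ::ₘ ψ ::ₘ Γ) Δ ?_ ?_ ?_ fun h => hn (.lAnd h)).of_forall_force ?_
    · intro a
      simp only [mem_seqBoxed_cons, Form.boxedSub, Finset.mem_union]
      tauto
    · intro a
      simp +contextual
    · have h₁ := four_mul_pow_le (show φ.weight < (φ.and ψ).weight by simp only [Form.weight]; omega)
      have h₂ := four_mul_pow_le (show ψ.weight < (φ.and ψ).weight by simp only [Form.weight]; omega)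
      simp only [seqCost_cons]
      linarith
    · intro M w
      simp only [forall_force_cons]
      exact fun h => ⟨⟨⟨h.1, h.2.1⟩, h.2.2⟩, id⟩
  by_cases hor : ∃ φ ψ, Form.or φ ψ ∈ Γ
  · obtain ⟨φ, ψ, h⟩ := hor
    obtain ⟨Γ, rfl⟩ := Multiset.exists_cons_of_mem h
    have h₁ := four_mul_pow_le (show φ.weight < (φ.or ψ).weight by simp only [Form.weight]; omega)
    have h₂ := four_mul_pow_le (show ψ.weight < (φ.or ψ).weight by simp only [Form.weight]; omega)
    by_cases hd : G4a (φ ::ₘ Γ) Δ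
    · refine (ih (ψ ::ₘ Γ) Δ ?_ ?_ ?_ fun h => hn (.lOr hd h)).of_forall_force ?_
      · intro a
        simp only [mem_seqBoxed_cons, Form.boxedSub, Finset.mem_union]
        tauto
      · intro a
        simp +contextual
      · simp only [seqCost_cons]
        linarith
      · intro M w
        simp only [forall_force_cons]
        exact fun h => ⟨⟨.inr h.1, h.2⟩, id⟩
    · refine (ih (φ ::ₘ Γ) Δ ?_ ?_ ?_ hd).of_forall_force ?_
      · intro a
        simp only [mem_seqBoxed_cons, Form.boxedSub, Finset.mem_union]
        tauto
      · intro a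
        simp +contextual
      · simp only [seqCost_cons]
        linarith
      · intro M w
        simp only [forall_force_cons]
        exact fun h => ⟨⟨.inl h.1, h.2⟩, id⟩
  by_cases hat : ∃ p φ, Form.atom p ∈ Γ ∧ Form.imp (Form.atom p) φ ∈ Γ
  · obtain ⟨p, φ, hp, h⟩ := hat
    obtain ⟨Γ, rfl⟩ := Multiset.exists_cons_of_mem hp
    obtain ⟨Γ, rfl⟩ := Multiset.exists_cons_of_mem
      ((Multiset.mem_cons.1 h).resolve_left (by simp))
    refine (ih (.atom p ::ₘ φ ::ₘ Γ) Δ ?_ ?_ ?_ fun h => hn (.lAtImp h)).of_forall_force ?_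
    · intro a
      simp only [mem_seqBoxed_cons, Form.boxedSub, Finset.mem_union]
      tauto
    · intro a
      simp +contextual
    · have h₁ := four_mul_pow_le (show φ.weight < ((Form.atom p).imp φ).weight by
        simp only [Form.weight]; omega)
      simp only [seqCost_cons]
      linarith
    · intro M w
      simp only [forall_force_cons]
      exact fun h => ⟨⟨h.1, force_imp_of_force h.2.1, h.2.2⟩, id⟩
  by_cases handimp : ∃ φ ψ χ, Form.imp (Form.and φ ψ) χ ∈ Γ
  · obtain ⟨φ, ψ, χ, h⟩ := handimp
    obtain ⟨Γ, rfl⟩ := Multiset.exists_cons_of_mem h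
    refine (ih (φ.imp (ψ.imp χ) ::ₘ Γ) Δ ?_ ?_ ?_ fun h => hn (.lAndImp h)).of_forall_force ?_
    · intro a
      simp only [mem_seqBoxed_cons, Form.boxedSub, Finset.mem_union]
      tauto
    · intro a
      simp +contextual
    · have h₁ := four_mul_pow_le (show (φ.imp (ψ.imp χ)).weight < ((φ.and ψ).imp χ).weight by
        simp only [Form.weight]; omega)
      simp only [seqCost_cons]
      linarith
    · intro M w
      simp only [forall_force_cons]
      exact fun h => ⟨⟨fun v hv hva => h.1 v hv hva.1 v (M.le_refl v) hva.2, h.2⟩, id⟩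
  by_cases horimp : ∃ φ ψ χ, Form.imp (Form.or φ ψ) χ ∈ Γ
  · obtain ⟨φ, ψ, χ, h⟩ := horimp
    obtain ⟨Γ, rfl⟩ := Multiset.exists_cons_of_mem h
    refine (ih (φ.imp χ ::ₘ ψ.imp χ ::ₘ Γ) Δ ?_ ?_ ?_
      fun h => hn (.lOrImp h)).of_forall_force ?_
    · intro a
      simp only [mem_seqBoxed_cons, Form.boxedSub, Finset.mem_union]
      tauto
    · intro a
      simp +contextual
    · have hpos : ∀ φ : Form, 0 < φ.weight := fun φ => by cases φ <;> simp [Form.weight]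
      have h₁ := four_mul_pow_le (show (φ.imp χ).weight < ((φ.or ψ).imp χ).weight by
        have := hpos ψ
        simp only [Form.weight]; omega)
      have h₂ := four_mul_pow_le (show (ψ.imp χ).weight < ((φ.or ψ).imp χ).weight by
        have := hpos φ
        simp only [Form.weight]; omega)
      simp only [seqCost_cons]
      linarith
    · intro M w
      simp only [forall_force_cons]
      exact fun h => ⟨⟨fun v hv hva => hva.elim (h.1 v hv) (h.2.1 v hv), h.2.2⟩, id⟩
  by_cases himp : ∃ φ ψ χ Θ, Γ = Form.imp (Form.imp φ ψ) χ ::ₘ Θ ∧ ¬ G4a (χ ::ₘ Θ) Δ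
  · obtain ⟨φ, ψ, χ, Γ, rfl, h⟩ := himp
    refine (ih _ Δ ?_ ?_ ?_ h).of_forall_force ?_
    · intro a
      simp only [mem_seqBoxed_cons, Form.boxedSub, Finset.mem_union]
      tauto
    · intro a
      simp +contextual
    · have h₁ := four_mul_pow_le (show χ.weight < ((φ.imp ψ).imp χ).weight by
        simp only [Form.weight]; omega)
      simp only [seqCost_cons]
      linarith
    · intro M w
      simp only [forall_force_cons]
      exact fun h => ⟨⟨force_imp_of_force h.1, h.2⟩, id⟩
  by_cases hbox : ∃ φ χ Θ, Γ = Form.imp (Form.box φ) χ ::ₘ Θ ∧ ¬ G4a (χ ::ₘ Θ) Δ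
  · obtain ⟨φ, χ, Γ, rfl, h⟩ := hbox
    refine (ih _ Δ ?_ ?_ ?_ h).of_forall_force ?_
    · intro a
      simp only [mem_seqBoxed_cons, Form.boxedSub, Finset.mem_union]
      tauto
    · intro a
      simp +contextual
    · have h₁ := four_mul_pow_le (show χ.weight < ((Form.box φ).imp χ).weight by
        simp only [Form.weight]; omega)
      simp only [seqCost_cons]
      linarith
    · intro M w
      simp only [forall_force_cons]
      exact fun h => ⟨⟨force_imp_of_force h.1, h.2⟩, id⟩
  by_cases hsand : ∃ φ ψ, Δ = some (Form.and φ ψ)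
  · obtain ⟨φ, ψ, rfl⟩ := hsand
    have h₁ := four_mul_pow_le (show φ.weight < (φ.and ψ).weight by simp only [Form.weight]; omega)
    have h₂ := four_mul_pow_le (show ψ.weight < (φ.and ψ).weight by simp only [Form.weight]; omega)
    by_cases hd : G4a Γ (some φ)
    · refine (ih Γ (some ψ) ?_ (fun _ => id) ?_ fun h => hn (.rAnd hd h)).of_forall_force ?_
      · intro a
        simp only [mem_seqBoxed_some, Form.boxedSub, Finset.mem_union]
        tauto
      · simp only [seqCost_some]
        linarith
      · intro M w h
        simp only [forceSuc_some]
        exact ⟨h, And.right⟩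
    · refine (ih Γ (some φ) ?_ (fun _ => id) ?_ hd).of_forall_force ?_
      · intro a
        simp only [mem_seqBoxed_some, Form.boxedSub, Finset.mem_union]
        tauto
      · simp only [seqCost_some]
        linarith
      · intro M w h
        simp only [forceSuc_some]
        exact ⟨h, And.left⟩
  by_cases hsimp : ∃ φ ψ, Δ = some (Form.imp φ ψ)
  · obtain ⟨φ, ψ, rfl⟩ := hsimp
    refine (ih (φ ::ₘ Γ) (some ψ) ?_ ?_ ?_ fun h => hn (.rImp h)).of_forall_force ?_
    · intro a
      simp only [mem_seqBoxed_cons, mem_seqBoxed_some, Form.boxedSub, Finset.mem_union]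
      tauto
    · intro a
      simp +contextual
    · have h₁ := four_mul_pow_le (show φ.weight < (φ.imp ψ).weight by
        simp only [Form.weight]; omega)
      have h₂ := four_mul_pow_le (show ψ.weight < (φ.imp ψ).weight by
        simp only [Form.weight]; omega)
      simp only [seqCost_cons, seqCost_some]
      linarith
    · intro M w
      simp only [forall_force_cons, forceSuc_some]
      exact fun h => ⟨h.2, fun h' => h' w (M.le_refl w) h.1⟩
  push Not at hand hor hat handimp horimp himp hbox hsand hsimp
  refine hasCountermodel_of_saturated hand hor ?_ hat handimp horimp ?_ ?_ ?_ hsand hsimp ?_ ?_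
  · intro h
    obtain ⟨Γ, rfl⟩ := Multiset.exists_cons_of_mem h
    exact hn .axBot
  · intro φ ψ χ h
    obtain ⟨Γ, rfl⟩ := Multiset.exists_cons_of_mem h
    refine (ih (φ ::ₘ ψ.imp χ ::ₘ Γ) (some ψ) ?_ ?_ ?_
      fun h => hn (.lImpImpA h (himp _ _ _ _ rfl))).refutable ?_
    · intro a
      have := @seqBoxed_none_subset Γ Δ a
      simp only [mem_seqBoxed_cons, mem_seqBoxed_some, Form.boxedSub, Finset.mem_union]
      tauto
    · intro a
      simp +contextual
    · have h₁ := four_mul_pow_le (show φ.weight < ((φ.imp ψ).imp χ).weight by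
        simp only [Form.weight]; omega)
      have h₂ := four_mul_pow_le (show ψ.weight < ((φ.imp ψ).imp χ).weight by
        simp only [Form.weight]; omega)
      have h₃ := four_mul_pow_le (show (ψ.imp χ).weight < ((φ.imp ψ).imp χ).weight by
        simp only [Form.weight]; omega)
      have h₄ := @seqCost_none_le Γ Δ
      simp only [seqCost_cons, seqCost_some]
      linarith
    · intro M w
      simp only [forall_force_cons]
      refine fun h => ⟨⟨fun v hv hva => ?_, h.2.2⟩, by simp, fun h' => h' w (M.le_refl w) h.1⟩
      exact h.2.1 v hv (hva v (M.le_refl v) (force_mono M φ hv h.1))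
  · intro φ χ h
    obtain ⟨Γ, rfl⟩ := Multiset.exists_cons_of_mem h
    have hd := hbox _ _ _ rfl
    obtain ⟨P, Γ, hP, rfl⟩ := exists_eq_add_boxM Γ
    have hφ : Form.box φ ∉ boxM Γ := fun h => hn (.impSL2 hP h hd)
    have hφ' : φ ∉ Γ := by simpa [boxM] using hφ
    refine (ihbox ((Form.box φ).imp χ ::ₘ Form.box φ ::ₘ (P + boxdot Γ)) (some φ) φ ?_ ?_ ?_ ?_ ?_
      fun h => hn (.impSL1 hP hφ h hd)).refutable ?_
    · intro a
      have h₁ := @seqBoxed_none_subset (P + boxM Γ) Δ a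
      have h₂ := @seqBoxed_boxdot P Γ a
      simp only [mem_seqBoxed_cons, mem_seqBoxed_some, Form.boxedSub, Finset.mem_union,
        Finset.mem_insert]
      tauto
    · intro a
      simp only [boxdot, Multiset.mem_cons, Multiset.mem_add]
      tauto
    · simp [mem_seqBoxed_cons, Form.boxedSub]
    · simp [box_mem_add_boxM hP, hφ']
    · simp
    · intro M w
      simp only [forall_force_cons]
      refine fun h => ⟨⟨h.1, fun ψ hψ => h.2.2 ψ ?_⟩, fun _ ψ hψ => h.2.2 ψ ?_, id⟩
      · simp only [boxdot, Multiset.mem_add] at hψ ⊢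
        tauto
      · have : ψ ∈ Γ := by simpa [box_mem_add_boxM hP] using hψ
        simp [boxdot, this]
  · rintro p rfl h
    exact hn (.of_mem h)
  · rintro φ ψ rfl
    have h₁ := four_mul_pow_le (show φ.weight < (φ.or ψ).weight by simp only [Form.weight]; omega)
    have h₂ := four_mul_pow_le (show ψ.weight < (φ.or ψ).weight by simp only [Form.weight]; omega)
    constructor
    · refine (ih Γ (some φ) ?_ (fun _ => id) ?_ fun h => hn (.rOrL h)).refutable ?_
      · intro a
        simp only [mem_seqBoxed_some, Form.boxedSub, Finset.mem_union]
        tauto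
      · simp only [seqCost_some]
        linarith
      · exact fun M w h => ⟨h, by simp, id⟩
    · refine (ih Γ (some ψ) ?_ (fun _ => id) ?_ fun h => hn (.rOrR h)).refutable ?_
      · intro a
        simp only [mem_seqBoxed_some, Form.boxedSub, Finset.mem_union]
        tauto
      · simp only [seqCost_some]
        linarith
      · exact fun M w h => ⟨h, by simp, id⟩
  · rintro φ rfl
    have hφ : Form.box φ ∉ Γ := fun h => hn (.of_mem h)
    obtain ⟨P, Γ, hP, rfl⟩ := exists_eq_add_boxM Γ
    refine (ihbox (Form.box φ ::ₘ (P + boxdot Γ)) (some φ) φ ?_ ?_ ?_ hφ ?_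
      fun h => hn (.rSLa hP h)).refutable ?_
    · intro a
      have h₂ := @seqBoxed_boxdot P Γ a
      simp only [mem_seqBoxed_cons, mem_seqBoxed_some, Form.boxedSub, Finset.mem_insert]
      tauto
    · intro a
      simp only [boxdot, Multiset.mem_cons, Multiset.mem_add]
      tauto
    · simp [mem_seqBoxed_some, Form.boxedSub]
    · simp
    · intro M w
      simp only [forall_force_cons]
      refine fun h => ⟨fun ψ hψ => h.2 ψ ?_, fun _ ψ hψ => h.2 ψ ?_, id⟩
      · simp only [boxdot, Multiset.mem_add] at hψ ⊢
        tauto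
      · have : ψ ∈ Γ := (box_mem_add_boxM hP).1 hψ
        simp [boxdot, this]

theorem hasCountermodel_of_not_derivable (s : Multiset Form × Option Form) :
    ¬ G4a s.1 s.2 → HasCountermodel s.1 s.2 := by
  have wf : WellFounded (InvImage (Prod.Lex (· < ·) (· < ·))
      fun s : Multiset Form × Option Form =>
        ((seqMissing s.1 s.2).card, seqCost s.1 s.2)) :=
    InvImage.wf _ (WellFounded.prod_lex wellFounded_lt wellFounded_lt)
  induction s using wf.induction with
  | h s ih =>
  have hsub : ∀ Γ Δ, (∀ a, a ∈ seqBoxed Γ Δ → a ∈ seqBoxed s.1 s.2) →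
      (∀ a, Form.box a ∈ s.1 → Form.box a ∈ Γ) → seqMissing Γ Δ ⊆ seqMissing s.1 s.2 := by
    intro Γ Δ h₁ h₂ a ha
    simp only [seqMissing, Finset.mem_filter] at ha ⊢
    exact ⟨h₁ a ha.1, fun h => ha.2 (h₂ a h)⟩
  refine hasCountermodel_step ?_ ?_
  · intro Γ Δ h₁ h₂ hc
    refine ih (Γ, Δ) (Prod.lex_def.2 ?_)
    rcases (Finset.card_le_card (hsub Γ Δ h₁ h₂)).lt_or_eq with h | h
    · exact .inl h
    · exact .inr ⟨h, hc⟩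
  · intro Γ Δ a h₁ h₂ ha hna hΓ
    refine ih (Γ, Δ) (.left _ _ (Finset.card_lt_card ((Finset.ssubset_iff_of_subset
      (hsub Γ Δ h₁ h₂)).2 ⟨a, ?_, ?_⟩)))
    · simp [seqMissing, ha, hna]
    · simp [seqMissing, hΓ]

/-- completeness of G4iSL□ᵃ with respect to (finite) iSL-models:
an underivable sequent is refuted in a finite iSL-model; equivalently, every
semantically valid sequent is derivable. -/
theorem g4a_completeness :
    (∀ (Γ : Multiset Form) (Δ : Option Form), ¬ G4a Γ Δ →
      ∃ M : ISLModel, Finite M.W ∧ ∃ w : M.W,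
        (∀ φ ∈ Γ, Force M w φ) ∧ ¬ ForceSuc M w Δ) ∧
    (∀ (Γ : Multiset Form) (Δ : Option Form), SemConseq Γ Δ → G4a Γ Δ) := by
  refine ⟨fun Γ Δ => hasCountermodel_of_not_derivable (Γ, Δ), fun Γ Δ h => ?_⟩
  by_contra hn
  obtain ⟨M, -, w, hw, hΔ⟩ := hasCountermodel_of_not_derivable (Γ, Δ) hn
  exact hΔ (h M w hw)
end
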